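/- Let H be an infinite-dimensional separable real or complex Hilbert space and let B be a bounded positive invertible operator on H. Let {a_i}_{i=1}^∞ be a sequence of positive real numbers with Σ_i a_i² = ∞ and sup_i a_i² < ‖B‖_ess. Then there exists a frame {z_i}_{i=1}^∞ for H whose frame operator equals B and such that ‖z_i‖ = a_i for all i. -/

import Mathlib

open scoped InnerProductSpace

/-- The essential norm of a bounded operator: `‖B‖_ess = inf {‖B - K‖ : K compact}`. -/
noncomputable def essNorm {𝕜 H : Type*} [RCLike 𝕜] [NormedAddCommGroup H]
    [InnerProductSpace 𝕜 H] (B : H →L[𝕜] H) : ℝ :=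
  sInf ((fun K => ‖B - K‖) '' {K : H →L[𝕜] H | IsCompactOperator K})

open InnerProductSpace

section

variable {𝕜 H : Type*} [RCLike 𝕜] [NormedAddCommGroup H] [InnerProductSpace 𝕜 H]

namespace ContinuousLinearMap

instance : IsOrderedAddMonoid (H →L[𝕜] H) where
  add_le_add_left a b hab c := by simpa [le_def]

/-- The Cauchy-Schwarz inequality for the form `⟪T x, y⟫` of a positive operator `T`. -/
theorem IsPositive.norm_inner_sq_le {T : H →L[𝕜] H} (hT : T.IsPositive) (x y : H) :
    ‖⟪T x, y⟫_𝕜‖ ^ 2 ≤ RCLike.re ⟪T x, x⟫_𝕜 * RCLike.re ⟪T y, y⟫_𝕜 := by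
  let c : PreInnerProductSpace.Core 𝕜 H :=
    { inner := fun x y => ⟪T x, y⟫_𝕜
      conj_inner_symm := fun x y => by
        rw [inner_conj_symm, hT.inner_left_eq_inner_right]
      re_inner_nonneg := hT.re_inner_nonneg_left
      add_left := fun x y z => by simp [inner_add_left]
      smul_left := fun x y r => by simp [inner_smul_left] }
  have h := @InnerProductSpace.Core.inner_mul_inner_self_le 𝕜 H _ _ _ c x y
  have h2 : ‖⟪T y, x⟫_𝕜‖ = ‖⟪T x, y⟫_𝕜‖ := by
    rw [hT.inner_left_eq_inner_right y x, norm_inner_symm]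
  calc ‖⟪T x, y⟫_𝕜‖ ^ 2 = ‖⟪T x, y⟫_𝕜‖ * ‖⟪T y, x⟫_𝕜‖ := by rw [h2, sq]
    _ ≤ _ := h

theorem IsPositive.norm_apply_sq_le {T : H →L[𝕜] H} (hT : T.IsPositive) {M : ℝ}
    (hM : ∀ v, RCLike.re ⟪T v, v⟫_𝕜 ≤ M * ‖v‖ ^ 2) (v : H) :
    ‖T v‖ ^ 2 ≤ M * RCLike.re ⟪T v, v⟫_𝕜 := by
  have h := hT.norm_inner_sq_le v (T v)
  have h0 := hT.re_inner_nonneg_left v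
  rw [inner_self_eq_norm_sq_to_K, norm_pow, RCLike.norm_ofReal, abs_norm] at h
  rcases (sq_nonneg ‖T v‖).eq_or_lt with h1 | h1
  · have : T v = 0 := by simpa using h1.symm
    simp [this]
  · have h2 := mul_le_mul_of_nonneg_left (hM (T v)) h0
    nlinarith

theorem re_inner_sub_rankOne (B : H →L[𝕜] H) (w v : H) :
    RCLike.re ⟪(B - rankOne 𝕜 w w) v, v⟫_𝕜 = RCLike.re ⟪B v, v⟫_𝕜 - ‖⟪w, v⟫_𝕜‖ ^ 2 := by
  rw [sub_apply, inner_sub_left, map_sub, rankOne_apply, inner_smul_left, RCLike.conj_mul]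
  norm_cast

theorem re_inner_mono {S T : H →L[𝕜] H} (h : S ≤ T) (v : H) :
    RCLike.re ⟪S v, v⟫_𝕜 ≤ RCLike.re ⟪T v, v⟫_𝕜 := by
  have := ((le_def _ _).1 h).re_inner_nonneg_left v
  rw [sub_apply, inner_sub_left, map_sub] at this
  linarith

theorem rankOne_self_le {B : H →L[𝕜] H} (hB : 0 ≤ B) {w : H}
    (h : ∀ v, ‖⟪w, v⟫_𝕜‖ ^ 2 ≤ RCLike.re ⟪B v, v⟫_𝕜) : rankOne 𝕜 w w ≤ B := by
  rw [nonneg_iff_isPositive] at hB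
  rw [le_def]
  refine ⟨?_, fun v => ?_⟩
  · exact hB.isSymmetric.sub (isSymmetric_rankOne_self w)
  · have := re_inner_sub_rankOne B w v
    have h2 := h v
    rw [reApplyInnerSelf, re_inner_sub_rankOne]
    exact sub_nonneg.2 (h v)

theorem rankOne_self_nonneg (w : H) : 0 ≤ rankOne 𝕜 w w :=
  (nonneg_iff_isPositive _).2 (isPositive_rankOne_self w)

/-- The image of `x` under a positive operator `B`, suitably rescaled, gives the rank-one piece of
`B` whose removal kills `x`. -/
theorem exists_rankOne_le_apply_eq {B : H →L[𝕜] H} (hB : 0 ≤ B) (x : H) :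
    ∃ z : H, rankOne 𝕜 z z ≤ B ∧ rankOne 𝕜 z z x = B x := by
  have hB' := (nonneg_iff_isPositive _).1 hB
  set q := RCLike.re ⟪B x, x⟫_𝕜 with hq
  have hq0 : 0 ≤ q := hB'.re_inner_nonneg_left x
  have hqx : ⟪B x, x⟫_𝕜 = (q : 𝕜) := (hB'.isSymmetric.coe_re_inner_apply_self x).symm
  rcases hq0.eq_or_lt with h0 | h0
  · refine ⟨0, by simpa using hB, ?_⟩
    have := hB'.norm_inner_sq_le x (B x)
    rw [← hq, ← h0, zero_mul] at this
    have h1 : ⟪B x, B x⟫_𝕜 = 0 := by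
      rw [← norm_eq_zero]
      exact pow_eq_zero_iff two_ne_zero |>.1 (le_antisymm this (sq_nonneg _))
    simp [inner_self_eq_zero.1 h1]
  · have hs : 0 < √q := Real.sqrt_pos.2 h0
    refine ⟨(((√q)⁻¹ : ℝ) : 𝕜) • B x, rankOne_self_le hB fun v => ?_, ?_⟩
    · have := hB'.norm_inner_sq_le x v
      rw [inner_smul_left, norm_mul, mul_pow, RCLike.norm_conj, RCLike.norm_ofReal, sq_abs,
        inv_pow, Real.sq_sqrt hq0, inv_mul_le_iff₀ h0]
      exact this
    · rw [rankOne_apply, inner_smul_left, hqx, smul_smul, RCLike.conj_ofReal]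
      norm_cast
      have : (√q)⁻¹ * q * (√q)⁻¹ = 1 := by
        field_simp
        exact (Real.sq_sqrt hq0).symm
      rw [this]
      simp

/-- Two orthogonal vectors can be rotated so that one of them attains a prescribed intermediate
norm, without changing the sum of the associated rank-one operators. -/
theorem exists_rotation {z w : H} (hzw : ⟪z, w⟫_𝕜 = 0) {c : ℝ}
    (h : (‖w‖ ^ 2 ≤ c ∧ c ≤ ‖z‖ ^ 2) ∨ (‖z‖ ^ 2 ≤ c ∧ c ≤ ‖w‖ ^ 2)) :
    ∃ u u' : H, ‖u‖ ^ 2 = c ∧ ‖u'‖ ^ 2 = ‖z‖ ^ 2 + ‖w‖ ^ 2 - c ∧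
      rankOne 𝕜 z z + rankOne 𝕜 w w = rankOne 𝕜 u u + rankOne 𝕜 u' u' := by
  obtain ⟨p, q, hp, hq, hpq, hc⟩ : ∃ p q : ℝ, 0 ≤ p ∧ 0 ≤ q ∧ p + q = 1 ∧
      p * ‖z‖ ^ 2 + q * ‖w‖ ^ 2 = c := by
    have : c ∈ segment ℝ (‖z‖ ^ 2) (‖w‖ ^ 2) := by
      rw [segment_eq_uIcc, Set.mem_uIcc]
      tauto
    simpa [segment] using this
  have key : ∀ a b : ℝ, ‖(a : 𝕜) • z + (b : 𝕜) • w‖ ^ 2 = a ^ 2 * ‖z‖ ^ 2 + b ^ 2 * ‖w‖ ^ 2 := by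
    intro a b
    rw [@norm_add_sq 𝕜, inner_smul_left, inner_smul_right, hzw]
    simp [norm_smul, mul_pow]
  refine ⟨((√p : ℝ) : 𝕜) • z + ((√q : ℝ) : 𝕜) • w,
    ((-√q : ℝ) : 𝕜) • z + ((√p : ℝ) : 𝕜) • w, ?_, ?_, ?_⟩
  · rw [key, Real.sq_sqrt hp, Real.sq_sqrt hq, hc]
  · rw [key, neg_sq, Real.sq_sqrt hp, Real.sq_sqrt hq, ← hc]
    linear_combination (‖z‖ ^ 2 + ‖w‖ ^ 2) * hpq
  · have hpq' : ((√p : ℝ) : 𝕜) * ((√p : ℝ) : 𝕜) + ((√q : ℝ) : 𝕜) * ((√q : ℝ) : 𝕜) = 1 := by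
      norm_cast
      rw [Real.mul_self_sqrt hp, Real.mul_self_sqrt hq, hpq]
    ext v
    simp only [add_apply, rankOne_apply, inner_add_left, inner_smul_left, RCLike.conj_ofReal, map_neg]
    linear_combination (norm := module) (-hpq') • (⟪z, v⟫_𝕜 • z + ⟪w, v⟫_𝕜 • w)

end ContinuousLinearMap

open ContinuousLinearMap

theorem isCompactOperator_rankOne (x y : H) : IsCompactOperator (rankOne 𝕜 x y) := by
  rw [rankOne_def']
  exact (isCompactOperator_of_locallyCompactSpace_rng
    (ContinuousLinearMap.toSpanSingleton 𝕜 x)).comp_clm (innerSL 𝕜 y)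

theorem essNorm_le_norm_sub (B : H →L[𝕜] H) {K : H →L[𝕜] H} (hK : IsCompactOperator K) :
    essNorm B ≤ ‖B - K‖ :=
  csInf_le ⟨0, by rintro _ ⟨K, -, rfl⟩; exact norm_nonneg _⟩ ⟨K, hK, rfl⟩

theorem essNorm_le_essNorm_sub (B : H →L[𝕜] H) {K : H →L[𝕜] H} (hK : IsCompactOperator K) :
    essNorm B ≤ essNorm (B - K) := by
  refine le_csInf ⟨_, 0, isCompactOperator_zero, rfl⟩ ?_
  rintro _ ⟨L, hL, rfl⟩
  dsimp only
  rw [sub_sub]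
  exact essNorm_le_norm_sub B (hK.add hL)

/-- A number below the essential norm of a positive operator is exceeded by its quadratic form
somewhere on any hyperplane. -/
theorem exists_lt_re_inner_of_lt_essNorm [CompleteSpace H] {B : H →L[𝕜] H} (hB : 0 ≤ B) {s : ℝ}
    (hs0 : 0 ≤ s) (hs : s < essNorm B) (y : H) :
    ∃ g : H, ⟪y, g⟫_𝕜 = 0 ∧ s * ‖g‖ ^ 2 < RCLike.re ⟪B g, g⟫_𝕜 := by
  by_contra! hcon
  have hB' := (nonneg_iff_isPositive _).1 hB
  set U : Submodule 𝕜 H := 𝕜 ∙ y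
  have hT := hB'.conj_starProjection Uᗮ
  set P := Uᗮ.starProjection
  set T := P ∘L B ∘L P with hTdef
  have hTs : ∀ v, RCLike.re ⟪T v, v⟫_𝕜 ≤ s * ‖v‖ ^ 2 := by
    intro v
    have h1 : ⟪T v, v⟫_𝕜 = ⟪B (P v), P v⟫_𝕜 :=
      Submodule.inner_starProjection_left_eq_right _ _ _
    rw [h1]
    refine (hcon (P v) ?_).trans ?_
    · exact Submodule.mem_orthogonal_singleton_iff_inner_right.1
        (Submodule.starProjection_apply_mem _ v)
    · gcongr
      exact Submodule.norm_starProjection_apply_le _ v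
  have hnorm : ‖T‖ ≤ s := by
    refine opNorm_le_bound _ hs0 fun v => ?_
    have h1 := hT.norm_apply_sq_le hTs v
    have h2 := mul_le_mul_of_nonneg_left (hTs v) hs0
    refine le_of_sq_le_sq ?_ (by positivity)
    nlinarith
  have : ProperSpace U := FiniteDimensional.proper 𝕜 U
  have hQ : IsCompactOperator U.starProjection :=
    (isCompactOperator_of_locallyCompactSpace_rng U.subtypeL).comp_clm U.orthogonalProjectionOnto
  have hPQ : P = 1 - U.starProjection := Submodule.starProjection_orthogonal' U
  have hK : IsCompactOperator (B - T) := by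
    have : B - T = U.starProjection ∘L B + P ∘L B ∘L U.starProjection := by
      ext v
      simp [hTdef, hPQ]
      abel
    rw [this]
    exact (hQ.comp_clm B).add ((hQ.clm_comp B).clm_comp P)
  have := essNorm_le_norm_sub B hK
  rw [sub_sub_cancel] at this
  linarith

theorem exists_orthogonal_rankOne_le [CompleteSpace H] {B : H →L[𝕜] H} (hB : 0 ≤ B) {s l : ℝ}
    (hl0 : 0 ≤ l) (hls : l ≤ s) (hs : s < essNorm B) (z : H) :
    ∃ w : H, ⟪z, w⟫_𝕜 = 0 ∧ ‖w‖ ^ 2 = l ∧ rankOne 𝕜 w w ≤ B := by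
  have hB' := (nonneg_iff_isPositive _).1 hB
  have hs0 := hl0.trans hls
  obtain ⟨g, hg, hgs⟩ := exists_lt_re_inner_of_lt_essNorm hB hs0 hs (B z)
  set q := RCLike.re ⟪B g, g⟫_𝕜 with hq
  have hq0 : 0 < q := lt_of_le_of_lt (by positivity) hgs
  have hqB : q ≤ ‖B g‖ * ‖g‖ := (RCLike.re_le_norm _).trans (norm_inner_le_norm _ _)
  have hBg : 0 < ‖B g‖ := by
    by_contra! h
    nlinarith [norm_nonneg g]
  have hg0 : 0 < ‖g‖ := by
    by_contra! h
    nlinarith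
  have hlq : l * q ≤ ‖B g‖ ^ 2 := by
    have h1 : q * q ≤ ‖B g‖ ^ 2 * ‖g‖ ^ 2 := by nlinarith
    have h2 : l * ‖g‖ ^ 2 ≤ q := by nlinarith [sq_nonneg ‖g‖]
    have h3 : 0 < ‖g‖ ^ 2 := by positivity
    refine le_of_mul_le_mul_right ?_ h3
    nlinarith
  refine ⟨((√l / ‖B g‖ : ℝ) : 𝕜) • B g, ?_, ?_, rankOne_self_le hB fun v => ?_⟩
  · rw [inner_smul_right, ← hB'.inner_left_eq_inner_right, hg, mul_zero]
  · rw [norm_smul, RCLike.norm_ofReal, abs_of_nonneg (by positivity),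
      div_mul_cancel₀ _ hBg.ne', Real.sq_sqrt hl0]
  · rw [inner_smul_left, norm_mul, mul_pow, RCLike.norm_conj, RCLike.norm_ofReal, sq_abs,
      div_pow, Real.sq_sqrt hl0, div_mul_eq_mul_div, div_le_iff₀ (by positivity)]
    have h1 := hB'.norm_inner_sq_le g v
    have h2 := hB'.re_inner_nonneg_left v
    have h3 := mul_le_mul_of_nonneg_left h1 hl0
    nlinarith

/-- `Reducible δ c n t`: starting with the amount `t`, there is a strategy that ends at `0` and
that consumes successively `c n, c (n + 1), …`, where in each step one may either subtract the
current term, or, if the term is larger than the amount, raise the amount by at most `δ`. -/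
inductive Reducible (δ : ℝ) (c : ℕ → ℝ) : ℕ → ℝ → Prop
  | zero (n : ℕ) : Reducible δ c n 0
  | down {n : ℕ} {t : ℝ} : c n ≤ t → Reducible δ c (n + 1) (t - c n) → Reducible δ c n t
  | up {n : ℕ} {t t' : ℝ} : t ≤ c n → t ≤ t' → t' ≤ t + δ → Reducible δ c (n + 1) t' →
      Reducible δ c n t

theorem Reducible.exists_mem_Icc {δ s : ℝ} (hδ : 0 < δ) {c : ℕ → ℝ} (hcs : ∀ i, c i ≤ s)
    (hdiv : ∀ n M, ∃ m, M < ∑ i ∈ Finset.range m, c (n + i)) (k : ℕ) :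
    ∀ (n : ℕ) (t L : ℝ), 0 ≤ t → 0 ≤ L → s ≤ L + k * δ → ∃ t₀ ∈ Set.Icc t (t + L),
      Reducible δ c n t₀ := by
  induction k with
  | zero =>
    intro n t L ht hL hs
    obtain ⟨m, hm⟩ := hdiv n t
    induction m generalizing n t with
    | zero => simp at hm; linarith
    | succ m ih =>
      by_cases hct : c n ≤ t
      · obtain ⟨t₀, ⟨h1, h2⟩, h3⟩ := ih (n + 1) (t - c n) (by linarith) (by
          rw [Finset.sum_range_succ'] at hm
          simp only [add_zero, add_right_comm n 1, add_assoc] at hm ⊢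
          linarith)
        exact ⟨t₀ + c n, ⟨by linarith, by linarith⟩, .down (by linarith) (by simpa using h3)⟩
      · refine ⟨c n, ⟨by linarith, ?_⟩, .down le_rfl (by simpa using .zero _)⟩
        have := hcs n
        simp at hs
        linarith
  | succ k IH =>
    intro n t L ht hL hs
    obtain ⟨m, hm⟩ := hdiv n t
    induction m generalizing n t with
    | zero => simp at hm; linarith
    | succ m ih =>
      by_cases hct : c n ≤ t
      · obtain ⟨t₀, ⟨h1, h2⟩, h3⟩ := ih (n + 1) (t - c n) (by linarith) (by
          rw [Finset.sum_range_succ'] at hm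
          simp only [add_zero, add_right_comm n 1, add_assoc] at hm ⊢
          linarith)
        exact ⟨t₀ + c n, ⟨by linarith, by linarith⟩, .down (by linarith) (by simpa using h3)⟩
      · by_cases hcL : c n ≤ t + L
        · exact ⟨c n, ⟨by linarith, hcL⟩, .down le_rfl (by simpa using .zero _)⟩
        · obtain ⟨t₁, ⟨h1, h2⟩, h3⟩ := IH (n + 1) t (L + δ) ht (by linarith) (by
            push_cast at hs
            linarith)
          refine ⟨min t₁ (t + L), ⟨le_min h1 (by linarith), min_le_right _ _⟩,
            .up ((min_le_right _ _).trans (by linarith)) (min_le_left _ _) ?_ h3⟩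
          rw [← min_add_add_right]
          exact le_min (by linarith) (by linarith)

theorem reducible {δ s : ℝ} (hδ : 0 < δ) {c : ℕ → ℝ} (hcs : ∀ i, c i ≤ s)
    (hdiv : ∀ n M, ∃ m, M < ∑ i ∈ Finset.range m, c (n + i)) (n : ℕ) {t : ℝ} (ht : 0 ≤ t) :
    Reducible δ c n t := by
  obtain ⟨k, hk⟩ := exists_nat_ge (s / δ)
  rw [div_le_iff₀ hδ] at hk
  obtain ⟨t₀, ⟨h1, h2⟩, h⟩ := Reducible.exists_mem_Icc hδ hcs hdiv k n t 0 ht le_rfl (by linarith)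
  rwa [le_antisymm h1 (by linarith)]

/-- What is left of `B` after subtracting the rank-one operators of the first `n` vectors. -/
noncomputable def remainder (B : H →L[𝕜] H) (z : ℕ → H) (n : ℕ) : H →L[𝕜] H :=
  B - ∑ i ∈ Finset.range n, rankOne 𝕜 (z i) (z i)

theorem remainder_congr (B : H →L[𝕜] H) {z z' : ℕ → H} {n : ℕ} (h : ∀ i < n, z' i = z i) :
    remainder B z' n = remainder B z n := by
  unfold remainder
  congr 1
  exact Finset.sum_congr rfl fun i hi => by rw [h i (Finset.mem_range.1 hi)]

theorem remainder_update (B : H →L[𝕜] H) (z : ℕ → H) (n : ℕ) (u : H) :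
    remainder B (Function.update z n u) (n + 1) = remainder B z n - rankOne 𝕜 u u := by
  have h : ∀ i < n, Function.update z n u i = z i := fun i hi =>
    Function.update_of_ne hi.ne _ _
  rw [← remainder_congr B h]
  simp only [remainder, Finset.sum_range_succ, Function.update_self]
  abel

theorem norm_sq_update {c : ℕ → ℝ} {z : ℕ → H} {n : ℕ} (hz : ∀ i < n, ‖z i‖ ^ 2 = c i) {u : H}
    (hu : ‖u‖ ^ 2 = c n) : ∀ i < n + 1, ‖Function.update z n u i‖ ^ 2 = c i := by
  intro i hi
  rcases (Nat.lt_succ_iff.1 hi).eq_or_lt with rfl | h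
  · simpa using hu
  · simpa [Function.update_of_ne h.ne] using hz i h

/-- A rank-one piece whose squared norm is reducible can be removed from the remainder by
finitely many further vectors of prescribed norm. -/
theorem Reducible.exists_extension [CompleteSpace H] {δ s : ℝ} {c : ℕ → ℝ}
    (hc0 : ∀ i, 0 ≤ c i) (hcs : ∀ i, c i ≤ s) (B : H →L[𝕜] H) {n : ℕ} {t : ℝ}
    (h : Reducible δ c n t) :
    ∀ (R : H →L[𝕜] H) (x : H) (z : ℕ → H), ‖x‖ ^ 2 = t → 0 ≤ R → s + δ < essNorm R →
      remainder B z n = rankOne 𝕜 x x + R → (∀ i < n, ‖z i‖ ^ 2 = c i) →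
      ∃ N ≥ n, ∃ z' : ℕ → H, (∀ i < n, z' i = z i) ∧ (∀ i < N, ‖z' i‖ ^ 2 = c i) ∧
        0 ≤ remainder B z' N ∧ remainder B z' N ≤ R ∧ s + δ < essNorm (remainder B z' N) := by
  have hext : ∀ {n : ℕ} {z : ℕ → H} {u : H} {z' : ℕ → H},
      (∀ i < n + 1, z' i = Function.update z n u i) → ∀ i < n, z' i = z i := by
    intro n z u z' h i hi
    rw [h i (by lia), Function.update_of_ne hi.ne]
  induction h with
  | zero n =>
    intro R x z hx hR hRs hrem hz
    have hx0 : x = 0 := by simpa using hx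
    have hrem' : remainder B z n = R := by simpa [hx0] using hrem
    exact ⟨n, le_rfl, z, fun _ _ => rfl, hz, hrem' ▸ hR, hrem'.le, hrem' ▸ hRs⟩
  | @down n t hct _ ih =>
    intro R x z hx hR hRs hrem hz
    obtain ⟨u, u', hu, hu', hsum⟩ := exists_rotation (𝕜 := 𝕜) (z := x) (w := 0) (by simp) (c := c n)
      (.inl (by simpa [hx] using ⟨hc0 n, hct⟩))
    obtain ⟨N, hN, z', h1, h2⟩ := ih R u' (Function.update z n u) (by simp [hu', hx]) hR hRs
      (by
        rw [remainder_update, hrem, sub_eq_iff_eq_add, add_right_comm, add_comm (rankOne 𝕜 u' u'),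
          ← hsum]
        simp) (norm_sq_update hz hu)
    exact ⟨N, by lia, z', hext h1, h2⟩
  | @up n t t' htc htt' ht' _ ih =>
    intro R x z hx hR hRs hrem hz
    have hcn := hc0 n
    have hcsn := hcs n
    obtain ⟨w, hxw, hw, hwR⟩ := exists_orthogonal_rankOne_le hR (l := c n + (t' - t)) (by linarith)
      (by linarith) hRs x
    obtain ⟨u, u', hu, hu', hsum⟩ := exists_rotation hxw (c := c n)
      (.inr ⟨by linarith, by linarith⟩)
    obtain ⟨N, hN, z', h1, h2, h3, h4, h5⟩ := ih (R - rankOne 𝕜 w w) u' (Function.update z n u)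
      (by rw [hu', hx, hw]; ring) (sub_nonneg.2 hwR)
      (hRs.trans_le (essNorm_le_essNorm_sub _ (isCompactOperator_rankOne w w)))
      (by
        rw [remainder_update, hrem, eq_sub_of_add_eq hsum]
        abel) (norm_sq_update hz hu)
    exact ⟨N, by lia, z', hext h1, h2, h3, h4.trans (sub_le_self _ (rankOne_self_nonneg w)), h5⟩

theorem apply_eq_zero_of_le {S T : H →L[𝕜] H} (hS : 0 ≤ S) (hST : S ≤ T) {x : H} (hx : T x = 0) :
    S x = 0 := by
  have h1 := re_inner_mono hST x
  have h2 := ((nonneg_iff_isPositive _).1 hS).norm_inner_sq_le x (S x)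
  have h3 := ((nonneg_iff_isPositive _).1 hS).re_inner_nonneg_left x
  simp only [hx, inner_zero_left, map_zero] at h1
  rw [le_antisymm h1 h3, zero_mul] at h2
  have h4 := pow_eq_zero_iff two_ne_zero |>.1 (le_antisymm h2 (sq_nonneg _))
  exact inner_self_eq_zero.1 (norm_eq_zero.1 h4)

theorem re_inner_le_norm_mul_sq (T : H →L[𝕜] H) (v : H) :
    RCLike.re ⟪T v, v⟫_𝕜 ≤ ‖T‖ * ‖v‖ ^ 2 :=
  calc RCLike.re ⟪T v, v⟫_𝕜 ≤ ‖T v‖ * ‖v‖ :=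
        (RCLike.re_le_norm _).trans (norm_inner_le_norm _ _)
    _ ≤ ‖T‖ * ‖v‖ * ‖v‖ := by gcongr; exact T.le_opNorm v
    _ = ‖T‖ * ‖v‖ ^ 2 := by ring

theorem norm_apply_le_of_le {S T : H →L[𝕜] H} (hS : 0 ≤ S) (hST : S ≤ T) (v : H) :
    ‖S v‖ ≤ ‖T‖ * ‖v‖ := by
  have hM : ∀ v, RCLike.re ⟪S v, v⟫_𝕜 ≤ ‖T‖ * ‖v‖ ^ 2 := fun v =>
    (re_inner_mono hST v).trans (re_inner_le_norm_mul_sq T v)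
  have h1 := ((nonneg_iff_isPositive _).1 hS).norm_apply_sq_le hM v
  have h2 := mul_le_mul_of_nonneg_left (hM v) (norm_nonneg T)
  refine le_of_sq_le_sq ?_ (by positivity)
  nlinarith

/-- Starting from a partial decomposition, one can kill a given vector by finitely many further
vectors of prescribed norm. -/
theorem exists_extension_apply_eq_zero [CompleteSpace H] {δ s : ℝ} (hδ : 0 < δ) {c : ℕ → ℝ}
    (hc0 : ∀ i, 0 ≤ c i) (hcs : ∀ i, c i ≤ s)
    (hdiv : ∀ n M, ∃ m, M < ∑ i ∈ Finset.range m, c (n + i)) (B : H →L[𝕜] H) (x : H) {n : ℕ}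
    {z : ℕ → H} (hz : ∀ i < n, ‖z i‖ ^ 2 = c i) (hR : 0 ≤ remainder B z n)
    (hRs : s + δ < essNorm (remainder B z n)) :
    ∃ N > n, ∃ z' : ℕ → H, (∀ i < n, z' i = z i) ∧ (∀ i < N, ‖z' i‖ ^ 2 = c i) ∧
      0 ≤ remainder B z' N ∧ s + δ < essNorm (remainder B z' N) ∧ remainder B z' N x = 0 := by
  obtain ⟨w, -, hw, hwR⟩ := exists_orthogonal_rankOne_le hR (hc0 n)
    ((hcs n).trans (by linarith : s ≤ s + δ)) hRs 0
  have hR₁ : 0 ≤ remainder B (Function.update z n w) (n + 1) := by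
    rw [remainder_update]
    exact sub_nonneg.2 hwR
  obtain ⟨y, hyR, hyx⟩ := exists_rankOne_le_apply_eq hR₁ x
  obtain ⟨N, hN, z', h1, h2, h3, h4, h5⟩ :=
    (reducible hδ hcs hdiv (n + 1) (sq_nonneg ‖y‖)).exists_extension hc0 hcs B
      (remainder B (Function.update z n w) (n + 1) - rankOne 𝕜 y y) y (Function.update z n w) rfl
      (sub_nonneg.2 hyR)
      (by
        refine lt_of_lt_of_le ?_ (essNorm_le_essNorm_sub _ (isCompactOperator_rankOne y y))
        rw [remainder_update]
        exact hRs.trans_le (essNorm_le_essNorm_sub _ (isCompactOperator_rankOne w w)))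
      (by abel) (norm_sq_update hz hw)
  refine ⟨N, hN, z', fun i hi => ?_, h2, h3, h5, apply_eq_zero_of_le h3 h4 ?_⟩
  · rw [h1 i (by lia), Function.update_of_ne hi.ne]
  · rw [sub_apply, hyx, sub_self]

/-- A positive operator whose essential norm exceeds the bounded terms of a divergent series is
the limit of partial decompositions whose remainders successively kill a given sequence. -/
theorem exists_seq_remainder_apply_eq_zero [CompleteSpace H] {δ s : ℝ} (hδ : 0 < δ) {c : ℕ → ℝ}
    (hc0 : ∀ i, 0 ≤ c i) (hcs : ∀ i, c i ≤ s)
    (hdiv : ∀ n M, ∃ m, M < ∑ i ∈ Finset.range m, c (n + i)) {B : H →L[𝕜] H} (hB : 0 ≤ B)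
    (hBs : s + δ < essNorm B) (x : ℕ → H) :
    ∃ z : ℕ → H, (∀ i, ‖z i‖ ^ 2 = c i) ∧ (∀ n, 0 ≤ remainder B z n) ∧
      ∀ k, ∃ n, remainder B z n (x k) = 0 := by
  let P : ℕ × (ℕ → H) → Prop := fun p => (∀ i < p.1, ‖p.2 i‖ ^ 2 = c i) ∧
    0 ≤ remainder B p.2 p.1 ∧ s + δ < essNorm (remainder B p.2 p.1)
  have step : ∀ (k : ℕ) (p : {p // P p}), ∃ q : {p // P p}, p.1.1 < q.1.1 ∧
      (∀ i < p.1.1, q.1.2 i = p.1.2 i) ∧ remainder B q.1.2 q.1.1 (x k) = 0 := by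
    rintro k ⟨⟨n, z⟩, h1, h2, h3⟩
    obtain ⟨N, hN, z', h4, h5, h6, h7, h8⟩ :=
      exists_extension_apply_eq_zero hδ hc0 hcs hdiv B (x k) h1 h2 h3
    exact ⟨⟨⟨N, z'⟩, h5, h6, h7⟩, hN, h4, h8⟩
  choose next hlt hagree hkill using step
  let p₀ : {p // P p} := ⟨(0, 0), by simp, by simpa [remainder] using hB,
    by simpa [remainder] using hBs⟩
  let p : ℕ → {p // P p} := fun k => Nat.rec p₀ next k
  have hmono : StrictMono fun k => (p k).1.1 := strictMono_nat_of_lt_succ fun k => hlt k (p k)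
  have hag : ∀ k l, k ≤ l → ∀ i < (p k).1.1, (p l).1.2 i = (p k).1.2 i := by
    intro k l hkl
    induction l, hkl using Nat.le_induction with
    | base => exact fun _ _ => rfl
    | succ l hkl ih =>
      intro i hi
      exact (hagree l (p l) i (hi.trans_le (hmono.monotone hkl))).trans (ih i hi)
  have hlt' : ∀ i, i < (p (i + 1)).1.1 := fun i => Nat.lt_of_succ_le (hmono.id_le (i + 1))
  let z : ℕ → H := fun i => (p (i + 1)).1.2 i
  have hzp : ∀ k, ∀ i < (p k).1.1, z i = (p k).1.2 i := by
    intro k i hi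
    rcases le_total k (i + 1) with h | h
    · exact hag _ _ h i hi
    · exact (hag _ _ h i (hlt' i)).symm
  refine ⟨z, fun i => (p (i + 1)).2.1 i (hlt' i), fun n => ?_, fun k => ⟨(p (k + 1)).1.1, ?_⟩⟩
  · have h1 : 0 ≤ remainder B z (p n).1.1 := by
      rw [remainder_congr B (hzp n)]
      exact (p n).2.2.1
    refine h1.trans (sub_le_sub_left (Finset.sum_le_sum_of_subset_of_nonneg ?_ ?_) _)
    · exact Finset.range_subset_range.2 (hmono.id_le n)
    · exact fun i _ _ => rankOne_self_nonneg _
  · rw [remainder_congr B (hzp (k + 1))]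
    exact hkill k (p k)

theorem hasSum_of_remainder {B : H →L[𝕜] H} {z : ℕ → H}
    (hR : ∀ n, 0 ≤ remainder B z n) {x : ℕ → H} (hx : DenseRange x)
    (hker : ∀ k, ∃ n, remainder B z n (x k) = 0) (v : H) :
    HasSum (fun i => ⟪z i, v⟫_𝕜 • z i) (B v) := by
  rw [HasSum, SummationFilter.unconditional_filter, Metric.tendsto_atTop]
  intro ε hε
  obtain ⟨k, hk⟩ := hx.exists_dist_lt v (ε := ε / (‖B‖ + 1)) (by positivity)
  obtain ⟨n, hn⟩ := hker k
  refine ⟨Finset.range n, fun F hF => ?_⟩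
  set T : H →L[𝕜] H := B - ∑ i ∈ F, rankOne 𝕜 (z i) (z i) with hT
  have hnn : ∀ i : ℕ, 0 ≤ rankOne 𝕜 (z i) (z i) := fun i => rankOne_self_nonneg _
  have hT0 : 0 ≤ T := by
    obtain ⟨m, hm⟩ := F.exists_nat_subset_range
    exact (hR m).trans (sub_le_sub_left
      (Finset.sum_le_sum_of_subset_of_nonneg hm fun i _ _ => hnn i) _)
  have hTn : T ≤ remainder B z n :=
    sub_le_sub_left (Finset.sum_le_sum_of_subset_of_nonneg hF fun i _ _ => hnn i) _
  have hTB : T ≤ B := sub_le_self _ (Finset.sum_nonneg fun i _ => hnn i)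
  have hTx := apply_eq_zero_of_le hT0 hTn hn
  have hdist : dist (∑ i ∈ F, ⟪z i, v⟫_𝕜 • z i) (B v) = ‖T (v - x k)‖ := by
    rw [map_sub, hTx, sub_zero, dist_comm, dist_eq_norm]
    simp [hT, sum_apply]
  rw [hdist]
  rw [dist_eq_norm, lt_div_iff₀ (by positivity)] at hk
  have := norm_apply_le_of_le hT0 hTB (v - x k)
  nlinarith [norm_nonneg (v - x k)]

theorem exists_mul_norm_sq_le_re_inner {B : H →L[𝕜] H} (hB : B.IsPositive) (hBinv : IsUnit B) :
    ∃ C > 0, ∀ v : H, C * ‖v‖ ^ 2 ≤ RCLike.re ⟪B v, v⟫_𝕜 := by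
  obtain ⟨u, rfl⟩ := hBinv
  set A : H →L[𝕜] H := ↑u⁻¹ with hA
  set B : H →L[𝕜] H := ↑u with hBu
  have hAB : ∀ v, A (B v) = v := fun v => by
    rw [← mul_apply_eq_comp, hA, hBu, Units.inv_mul, one_apply_eq_self]
  refine ⟨((‖A‖ ^ 2 + 1) * (‖B‖ + 1))⁻¹, by positivity, fun v => ?_⟩
  have h1 := hB.norm_apply_sq_le (re_inner_le_norm_mul_sq B) v
  have h2 : ‖v‖ ^ 2 ≤ ‖A‖ ^ 2 * ‖B v‖ ^ 2 := by
    rw [← mul_pow]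
    gcongr
    simpa [hAB] using A.le_opNorm (B v)
  have h3 := hB.re_inner_nonneg_left v
  rw [inv_mul_le_iff₀ (by positivity)]
  calc ‖v‖ ^ 2 ≤ ‖A‖ ^ 2 * ‖B v‖ ^ 2 := h2
    _ ≤ (‖A‖ ^ 2 + 1) * ((‖B‖ + 1) * RCLike.re ⟪B v, v⟫_𝕜) := by
        gcongr
        · linarith
        · nlinarith
    _ = _ := by ring

end

open ContinuousLinearMap in
/-- Let `B` be a bounded positive invertible operator on an infinite-dimensional separable real
or complex Hilbert space `H`, and let `{a i}` be positive reals with `∑ a i ^ 2 = ∞` and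
`sup_i (a i)² < ‖B‖_ess`. Then there is a frame `{z i}` for `H` whose frame operator is `B`
(i.e. `B v = ∑ i ⟨v, z i⟩ z i`) and with `‖z i‖ = a i` for all `i`. -/
theorem exists_frame_with_frame_operator {𝕜 H : Type*} [RCLike 𝕜] [NormedAddCommGroup H]
    [InnerProductSpace 𝕜 H] [CompleteSpace H] [TopologicalSpace.SeparableSpace H]
    (hinf : ¬ FiniteDimensional 𝕜 H)
    (B : H →L[𝕜] H) (hB : B.IsPositive) (hBinv : IsUnit B)
    (a : ℕ → ℝ) (hapos : ∀ i, 0 < a i)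
    (hbdd : BddAbove (Set.range fun i => a i ^ 2))
    (hsup : ⨆ i, a i ^ 2 < essNorm B)
    (hdiv : Filter.Tendsto (fun N => ∑ i ∈ Finset.range N, a i ^ 2)
      Filter.atTop Filter.atTop) :
    ∃ z : ℕ → H, (∀ i, ‖z i‖ = a i) ∧
      (∃ C D : ℝ, 0 < C ∧ C ≤ D ∧ ∀ v : H,
        C * ‖v‖ ^ 2 ≤ ∑' i, ‖⟪z i, v⟫_𝕜‖ ^ 2 ∧ ∑' i, ‖⟪z i, v⟫_𝕜‖ ^ 2 ≤ D * ‖v‖ ^ 2) ∧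
      ∀ v : H, HasSum (fun i => ⟪z i, v⟫_𝕜 • z i) (B v) := by
  have hB0 := (nonneg_iff_isPositive _).2 hB
  obtain ⟨s', hs, hs'⟩ := exists_between hsup
  have hdiv' : ∀ n M, ∃ m, M < ∑ i ∈ Finset.range m, a (n + i) ^ 2 := by
    intro n M
    obtain ⟨m, hmn, hm⟩ := ((Filter.eventually_ge_atTop n).and
      (hdiv.eventually_gt_atTop (M + ∑ i ∈ Finset.range n, a i ^ 2))).exists
    refine ⟨m - n, ?_⟩
    obtain ⟨k, rfl⟩ := Nat.exists_eq_add_of_le hmn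
    rw [Finset.sum_range_add] at hm
    rw [Nat.add_sub_cancel_left]
    linarith
  obtain ⟨z, hz, hR, hker⟩ := exists_seq_remainder_apply_eq_zero (sub_pos.2 hs)
    (fun i => sq_nonneg (a i)) (le_ciSup hbdd) hdiv' hB0 (by rwa [add_sub_cancel])
    (TopologicalSpace.denseSeq H)
  have hsum := hasSum_of_remainder hR (TopologicalSpace.denseRange_denseSeq H) hker
  refine ⟨z, fun i => ?_, ?_, hsum⟩
  · exact (sq_eq_sq₀ (norm_nonneg _) (hapos i).le).1 (hz i)
  · obtain ⟨C, hC, hCB⟩ := exists_mul_norm_sq_le_re_inner hB hBinv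
    have htsum : ∀ v, ∑' i, ‖⟪z i, v⟫_𝕜‖ ^ 2 = RCLike.re ⟪B v, v⟫_𝕜 := by
      intro v
      rw [← inner_re_symm]
      have h := RCLike.hasSum_re 𝕜 ((hsum v).mapL (innerSL 𝕜 v))
      simp only [innerSL_apply_apply] at h
      rw [← h.tsum_eq]
      congr 1 with i
      rw [inner_smul_right, ← inner_conj_symm v, RCLike.mul_conj]
      norm_cast
    refine ⟨C, C + ‖B‖, hC, by simp, fun v => ?_⟩
    rw [htsum v]
    refine ⟨hCB v, (re_inner_le_norm_mul_sq B v).trans ?_⟩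
    gcongr
    linarith
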